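/- Suppose the N×N matrices L and F^{ab} (1 ≤ a,b ≤ r) over A satisfy, for some N²×N² matrix R over A, the trigonometric ECM relations: {L ⊗, L} = [R, L ⊗ 1] − [R^π, 1 ⊗ L] and {L ⊗, F^{ab}} = −[R^π, 1 ⊗ F^{ab}] + [C, 1 ⊗ F^{ab}] for all a, b. Then for all n, m ≥ 0 and all a, b: {Tr(L^n), Tr(L^m)} = 0 and {Tr(L^n), Tr(L^m F^{ab})} = 0. (The Tr(L^n) are the commuting trigonometric ECM Hamiltonians and the Tr(L^m F^{ab}) are the conserved Yangian-symmetry generators.) -/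

import Mathlib

open Matrix Kronecker

structure PoissonBr (A : Type*) [CommRing A] where
  br : A → A → A
  add_left : ∀ x y z, br (x + y) z = br x z + br y z
  add_right : ∀ x y z, br x (y + z) = br x y + br x z
  antisymm : ∀ x y, br x y = -br y x
  leibniz : ∀ x y z, br x (y * z) = br x y * z + y * br x z

/-- The matrix `{M ⊗, M'}` of pairwise brackets of entries. -/
def matBr {A : Type*} [CommRing A] {N : ℕ} (P : PoissonBr A)
    (M M' : Matrix (Fin N) (Fin N) A) :
    Matrix (Fin N × Fin N) (Fin N × Fin N) A :=
  fun p q => P.br (M p.1 q.1) (M' p.2 q.2)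

/-- `R^π`, the permuted matrix. -/
def piSwap {A : Type*} [CommRing A] {N : ℕ}
    (R : Matrix (Fin N × Fin N) (Fin N × Fin N) A) :
    Matrix (Fin N × Fin N) (Fin N × Fin N) A :=
  fun p q => R (p.2, p.1) (q.2, q.1)

/-- The Casimir matrix `C`, with entries `C_{(i,k),(j,l)} = δ_{il} δ_{kj}`. -/
def casC {A : Type*} [CommRing A] {N : ℕ} :
    Matrix (Fin N × Fin N) (Fin N × Fin N) A :=
  fun p q => if p.1 = q.2 ∧ p.2 = q.1 then 1 else 0

/-- Matrix commutator. -/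
def mComm {A : Type*} [CommRing A] {n : Type*} [Fintype n] (X Y : Matrix n n A) :
    Matrix n n A := X * Y - Y * X

namespace PoissonBr

variable {A : Type*} [CommRing A] (P : PoissonBr A)

/-- The Hamiltonian derivation `{x, ·}`. -/
def ham (x : A) : Derivation ℤ A A :=
  Derivation.mk' (AddMonoidHom.mk' (P.br x) (P.add_right x)).toIntLinearMap fun y z => by
    simp only [AddMonoidHom.coe_toIntLinearMap, AddMonoidHom.mk'_apply, smul_eq_mul,
      P.leibniz x y z]
    ring

@[simp]
theorem ham_apply (x y : A) : P.ham x y = P.br x y := rfl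

end PoissonBr

namespace Matrix

variable {A : Type*} [CommRing A]

theorem map_one_derivation {n : Type*} [DecidableEq n] (D : Derivation ℤ A A) :
    (1 : Matrix n n A).map D = 0 := by
  ext i j
  by_cases h : i = j <;> simp [h]

variable {n : Type*} [Fintype n]

theorem map_mul_derivation (D : Derivation ℤ A A) (X Y : Matrix n n A) :
    (X * Y).map D = X.map D * Y + X * Y.map D := by
  ext i j
  simp only [map_apply, mul_apply, add_apply, map_sum, Derivation.leibniz, smul_eq_mul,
    Finset.sum_add_distrib]
  rw [add_comm]
  simp only [mul_comm]

theorem trace_map_derivation (D : Derivation ℤ A A) (X : Matrix n n A) :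
    (X.map D).trace = D X.trace := by
  simp [trace]

theorem derivation_trace_pow [DecidableEq n] (D : Derivation ℤ A A) (X : Matrix n n A) (k : ℕ) :
    D (X ^ k).trace = k • (X ^ (k - 1) * X.map D).trace := by
  rw [← trace_map_derivation]
  suffices h : ∀ j, (X ^ j * (X ^ k).map D).trace = k • (X ^ (j + (k - 1)) * X.map D).trace by
    simpa using h 0
  induction k with
  | zero => simp [map_one_derivation]
  | succ k ih =>
    intro j
    rw [pow_succ, map_mul_derivation, mul_add, trace_add, ← mul_assoc, trace_mul_comm,
      ← mul_assoc, ← pow_succ', ih, ← mul_assoc, ← pow_add, add_tsub_cancel_right, succ_nsmul]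
    cases k with
    | zero => simp
    | succ k => simp only [add_tsub_cancel_right, add_assoc, add_comm 1 k]

/-- If a derivation acts on `X` as the commutator with `M`, so it does on powers of `X`. -/
theorem map_pow_derivation_of_lax [DecidableEq n] (D : Derivation ℤ A A) {X M : Matrix n n A}
    (h : X.map D = M * X - X * M) (k : ℕ) : (X ^ k).map D = M * X ^ k - X ^ k * M := by
  induction k with
  | zero => simp [map_one_derivation]
  | succ k ih =>
    rw [pow_succ, map_mul_derivation, ih, h]
    noncomm_ring

/-- The partial trace over the first tensor factor. -/
def partialTrace (T : Matrix (n × n) (n × n) A) : Matrix n n A :=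
  fun k l => ∑ i, T (i, k) (i, l)

theorem partialTrace_sub (S T : Matrix (n × n) (n × n) A) :
    partialTrace (S - T) = partialTrace S - partialTrace T := by
  ext k l
  simp [partialTrace, Finset.sum_sub_distrib]

variable [DecidableEq n]

theorem kronecker_one_mul_apply (X : Matrix n n A) (T : Matrix (n × n) (n × n) A) (i k : n)
    (q : n × n) : ((X ⊗ₖ (1 : Matrix n n A)) * T) (i, k) q = ∑ j, X i j * T (j, k) q := by
  simp [mul_apply, Fintype.sum_prod_type, one_apply]

theorem mul_kronecker_one_apply (X : Matrix n n A) (T : Matrix (n × n) (n × n) A) (p : n × n)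
    (j l : n) : (T * (X ⊗ₖ (1 : Matrix n n A))) p (j, l) = ∑ i, T p (i, l) * X i j := by
  simp [mul_apply, Fintype.sum_prod_type, one_apply]

theorem partialTrace_kronecker_one_mul (X : Matrix n n A) (T : Matrix (n × n) (n × n) A) :
    partialTrace ((X ⊗ₖ (1 : Matrix n n A)) * T) =
      partialTrace (T * (X ⊗ₖ (1 : Matrix n n A))) := by
  ext k l
  simp only [partialTrace, kronecker_one_mul_apply, mul_kronecker_one_apply]
  rw [Finset.sum_comm]
  simp only [mul_comm]

theorem partialTrace_one_kronecker_mul (Y : Matrix n n A) (T : Matrix (n × n) (n × n) A) :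
    partialTrace (((1 : Matrix n n A) ⊗ₖ Y) * T) = Y * partialTrace T := by
  ext k l
  have h (i : n) : (((1 : Matrix n n A) ⊗ₖ Y) * T) (i, k) (i, l) =
      ∑ j, Y k j * T (i, j) (i, l) := by
    simp only [mul_apply, Fintype.sum_prod_type_right]
    simp [one_apply]
  simp only [partialTrace, h, mul_apply, Finset.mul_sum]
  exact Finset.sum_comm

theorem partialTrace_mul_one_kronecker (Y : Matrix n n A) (T : Matrix (n × n) (n × n) A) :
    partialTrace (T * ((1 : Matrix n n A) ⊗ₖ Y)) = partialTrace T * Y := by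
  ext k l
  have h (i : n) : (T * ((1 : Matrix n n A) ⊗ₖ Y)) (i, k) (i, l) =
      ∑ j, T (i, k) (i, j) * Y j l := by
    simp only [mul_apply, Fintype.sum_prod_type_right]
    simp [one_apply]
  simp only [partialTrace, h, mul_apply, Finset.sum_mul]
  exact Finset.sum_comm

theorem partialTrace_mComm_kronecker_one {X Y : Matrix n n A} (h : Commute X Y)
    (T : Matrix (n × n) (n × n) A) :
    partialTrace ((X ⊗ₖ (1 : Matrix n n A)) * mComm T (Y ⊗ₖ (1 : Matrix n n A))) = 0 := by
  rw [mComm, mul_sub, partialTrace_sub, ← mul_assoc, ← partialTrace_kronecker_one_mul,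
    ← mul_assoc, ← mul_assoc, ← mul_kronecker_mul, ← mul_kronecker_mul, h.eq, sub_self]

theorem partialTrace_mComm_one_kronecker (X Y : Matrix n n A) (T : Matrix (n × n) (n × n) A) :
    partialTrace ((X ⊗ₖ (1 : Matrix n n A)) * mComm T ((1 : Matrix n n A) ⊗ₖ Y)) =
      mComm (partialTrace ((X ⊗ₖ (1 : Matrix n n A)) * T)) Y := by
  have h : (X ⊗ₖ (1 : Matrix n n A)) * ((1 : Matrix n n A) ⊗ₖ Y) =
      ((1 : Matrix n n A) ⊗ₖ Y) * (X ⊗ₖ (1 : Matrix n n A)) := by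
    simp [← mul_kronecker_mul]
  rw [mComm, mul_sub, partialTrace_sub, ← mul_assoc, partialTrace_mul_one_kronecker,
    ← mul_assoc, h, mul_assoc, partialTrace_one_kronecker_mul, mComm]

end Matrix

section PoissonTraces

variable {A : Type*} [CommRing A] {N : ℕ}

theorem partialTrace_kronecker_one_mul_casC (X : Matrix (Fin N) (Fin N) A) :
    partialTrace ((X ⊗ₖ (1 : Matrix (Fin N) (Fin N) A)) * casC) = X := by
  ext k l
  simp [partialTrace, kronecker_one_mul_apply, casC, ite_and]

theorem map_ham_trace_pow (P : PoissonBr A) (L X : Matrix (Fin N) (Fin N) A) (n : ℕ) :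
    X.map (P.ham (L ^ n).trace) =
      n • partialTrace (((L ^ (n - 1)) ⊗ₖ (1 : Matrix (Fin N) (Fin N) A)) * matBr P L X) := by
  ext k l
  rw [map_apply, P.ham_apply, P.antisymm, ← P.ham_apply, derivation_trace_pow, Matrix.smul_apply,
    ← smul_neg]
  congr 1
  simp only [partialTrace, kronecker_one_mul_apply]
  simp only [trace, diag_apply, mul_apply, matBr,
    map_apply, P.ham_apply, P.antisymm (X k l), mul_neg, Finset.sum_neg_distrib, neg_neg]

end PoissonTraces

theorem statement18 {A : Type*} [CommRing A] {N : ℕ} (P : PoissonBr A)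
    {r : ℕ} (hr : 1 ≤ r) (L : Matrix (Fin N) (Fin N) A)
    (F : Fin r → Fin r → Matrix (Fin N) (Fin N) A)
    (R : Matrix (Fin N × Fin N) (Fin N × Fin N) A)
    (hLL : matBr P L L =
      mComm R (L ⊗ₖ (1 : Matrix (Fin N) (Fin N) A)) -
        mComm (piSwap R) ((1 : Matrix (Fin N) (Fin N) A) ⊗ₖ L))
    (hLF : ∀ a b, matBr P L (F a b) =
      -mComm (piSwap R) ((1 : Matrix (Fin N) (Fin N) A) ⊗ₖ F a b) +
        mComm casC ((1 : Matrix (Fin N) (Fin N) A) ⊗ₖ F a b)) :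
    ∀ (n m : ℕ) (a b : Fin r),
      P.br ((L ^ n).trace) ((L ^ m).trace) = 0 ∧
      P.br ((L ^ n).trace) ((L ^ m * F a b).trace) = 0 := by
  intro n m a b
  set D := P.ham (L ^ n).trace with hD
  set M := n • -partialTrace (((L ^ (n - 1)) ⊗ₖ (1 : Matrix (Fin N) (Fin N) A)) * piSwap R)
    with hM
  have hL : L.map D = M * L - L * M := by
    rw [hD, map_ham_trace_pow, hLL, mul_sub, partialTrace_sub,
      partialTrace_mComm_kronecker_one (Commute.pow_self L _),
      partialTrace_mComm_one_kronecker, mComm, hM, smul_mul_assoc, mul_smul_comm, ← smul_sub]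
    congr 1
    noncomm_ring
  have hF : (F a b).map D =
      M * F a b - F a b * M + n • (L ^ (n - 1) * F a b - F a b * L ^ (n - 1)) := by
    rw [hD, map_ham_trace_pow, hLF, neg_add_eq_sub, mul_sub, partialTrace_sub,
      partialTrace_mComm_one_kronecker, partialTrace_mComm_one_kronecker,
      partialTrace_kronecker_one_mul_casC, mComm, mComm, hM, smul_mul_assoc, mul_smul_comm,
      ← smul_sub, ← smul_add]
    congr 1
    noncomm_ring
  have hLm := map_pow_derivation_of_lax D hL m
  constructor
  · rw [← P.ham_apply, ← trace_map_derivation, hLm, trace_sub, trace_mul_comm, sub_self]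
  · have hLax : (L ^ m * F a b).map D = M * (L ^ m * F a b) - L ^ m * F a b * M +
        n • (L ^ (n - 1) * (L ^ m * F a b) - L ^ m * F a b * L ^ (n - 1)) := by
      rw [map_mul_derivation, hLm, hF, ← mul_assoc (L ^ (n - 1)),
        ((Commute.refl L).pow_pow (n - 1) m).eq]
      simp only [mul_add, mul_sub, sub_mul, mul_smul_comm, mul_assoc]
      abel
    rw [← P.ham_apply, ← trace_map_derivation, hLax, trace_add, trace_smul, trace_sub, trace_sub,
      trace_mul_comm M, trace_mul_comm (L ^ (n - 1)), sub_self, sub_self, smul_zero, add_zero]
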